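/- If α is a nonzero algebraic number that is not a root of unity and there exist positive integers k > ℓ and n ≥ 2 with M^k(α) = M^ℓ(α)^n, then α is a wandering point under iteration of the Mahler measure. -/

import Mathlib

open Polynomial

noncomputable def intMinpoly (α : ℂ) : Polynomial ℤ :=
  (IsLocalization.integerNormalization (nonZeroDivisors ℤ) (minpoly ℚ α)).primPart

noncomputable def mahlerM (α : ℂ) : ℝ :=
  ((intMinpoly α).leadingCoeff.natAbs : ℝ) *
    (((intMinpoly α).map (Int.castRingHom ℂ)).roots.map (fun z => max 1 ‖z‖)).prod

noncomputable def mahlerC (α : ℂ) : ℂ := (mahlerM α : ℝ)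

def TorsionFree (α : ℂ) : Prop :=
  ∀ σ : ℂ ≃ₐ[ℚ] ℂ, σ α ≠ α → ∀ n : ℕ, 0 < n → (α / σ α) ^ n ≠ 1


lemma aux_strip (z : ℂ) : ∀ (n : ℕ) (q : ℂ[X]), q.support.card ≤ n →
    (∀ i, IsIntegral ℤ (((X - C z) * q).coeff i)) → ∀ i, IsIntegral ℤ (q.coeff i) := by
  intro n
  induction n with
  | zero =>
    intro q hq _ i
    have : q = 0 := by simpa using hq
    simp [this, isIntegral_zero]
  | succ n ih =>
    intro q hq h i
    by_cases hq0 : q = 0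
    · simp [hq0, isIntegral_zero]
    have ha : IsIntegral ℤ q.leadingCoeff := by
      have h1 : ((X - C z) * q).leadingCoeff = q.leadingCoeff := by
        rw [leadingCoeff_mul]; simp
      rw [← h1]; exact h _
    have haz : IsIntegral ℤ (q.leadingCoeff * z) := by
      have hl : ((X - C z) * q) ∈ lifts (algebraMap (integralClosure ℤ ℂ) ℂ) := by
        rw [lifts_iff_coeff_lifts]
        intro i
        exact ⟨⟨_, h i⟩, rfl⟩
      obtain ⟨P, hP⟩ := (mem_lifts _).1 hl
      have h2 : aeval z P = 0 := by
        rw [aeval_def, ← eval_map, hP]; simp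
      have h3 := isIntegral_leadingCoeff_smul P z h2
      have h4 : IsIntegral ℤ (P.leadingCoeff • z) := isIntegral_trans _ h3
      have h5 : (algebraMap (integralClosure ℤ ℂ) ℂ) P.leadingCoeff = q.leadingCoeff := by
        rw [← leadingCoeff_map_of_injective (FaithfulSMul.algebraMap_injective _ _), hP,
          leadingCoeff_mul]; simp
      rw [Algebra.smul_def, h5] at h4
      exact h4
    have key : ∀ i, IsIntegral ℤ (q.eraseLead.coeff i) := by
      apply ih
      · have := eraseLead_support_card_lt hq0
        omega
      · intro j
        have e : (X - C z) * q.eraseLead = (X - C z) * q -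
            (C q.leadingCoeff * X ^ (q.natDegree + 1) - C (q.leadingCoeff * z) * X ^ q.natDegree) := by
          have := q.eraseLead_add_C_mul_X_pow
          rw [C_mul, pow_succ]
          linear_combination (X - C z) * this
        rw [e, coeff_sub, coeff_sub, coeff_C_mul_X_pow, coeff_C_mul_X_pow]
        refine (h j).sub (IsIntegral.sub ?_ ?_) <;> split_ifs <;>
          first | assumption | exact isIntegral_zero
    rw [← q.eraseLead_add_C_mul_X_pow, coeff_add, coeff_C_mul_X_pow]
    refine (key i).add ?_
    split_ifs
    · exact ha
    · exact isIntegral_zero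

lemma aux_prod (c : ℂ) (t s : Multiset ℂ)
    (h : ∀ i, IsIntegral ℤ ((C c * ((s + t).map (fun z => X - C z)).prod).coeff i)) :
    IsIntegral ℤ (c * t.prod) := by
  induction s using Multiset.induction with
  | empty =>
    have := h 0
    rw [coeff_C_mul, coeff_zero_eq_eval_zero, eval_multiset_prod] at this
    simp at this
    rcases neg_one_pow_eq_or ℂ t.card with h1 | h1
    · rw [h1] at this; simpa using this
    · rw [h1] at this; simpa using this.neg
  | cons a s ih =>
    apply ih
    apply aux_strip a _ _ le_rfl
    intro i
    convert h i using 2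
    simp
    ring

lemma intMinpoly_primitive (α : ℂ) : (intMinpoly α).IsPrimitive := isPrimitive_primPart _

lemma intMinpoly_map (α : ℂ) (hα : IsAlgebraic ℚ α) :
    ∃ c : ℚ, c ≠ 0 ∧ (intMinpoly α).map (algebraMap ℤ ℚ) = C c * minpoly ℚ α := by
  obtain ⟨b, hb, h⟩ := IsLocalization.integerNormalization_spec (nonZeroDivisors ℤ) (minpoly ℚ α)
  have hb0 : b ≠ 0 := nonZeroDivisors.ne_zero hb
  set g := IsLocalization.integerNormalization (nonZeroDivisors ℤ) (minpoly ℚ α) with hg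
  have hg0 : g ≠ 0 := by
    rw [hg, Ne, IsLocalization.integerNormalization_eq_zero_iff le_rfl]
    exact minpoly.ne_zero hα.isIntegral
  have hc : g.content ≠ 0 := by simpa [content_eq_zero_iff] using hg0
  refine ⟨(b : ℚ) / g.content, by positivity, ?_⟩
  have h1 := g.eq_C_content_mul_primPart
  have h2 : C (g.content : ℚ) * (intMinpoly α).map (algebraMap ℤ ℚ) = C (b : ℚ) * minpoly ℚ α := by
    have : g.map (algebraMap ℤ ℚ) = C (b : ℚ) * minpoly ℚ α := by
      rw [h, zsmul_eq_mul]; simp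
    rw [← this]
    conv_rhs => rw [h1]
    simp [intMinpoly, hg]
  have hc' : (g.content : ℚ) ≠ 0 := by exact_mod_cast hc
  have h3 : C (g.content : ℚ) ≠ 0 := by simpa using hc
  apply mul_left_cancel₀ h3
  rw [h2, ← mul_assoc, ← C_mul]
  congr 2
  field_simp

lemma intMinpoly_roots (α : ℂ) (hα : IsAlgebraic ℚ α) :
    ((intMinpoly α).map (Int.castRingHom ℂ)).roots = (minpoly ℚ α).aroots ℂ := by
  obtain ⟨c, hc, h⟩ := intMinpoly_map α hα
  have : (intMinpoly α).map (Int.castRingHom ℂ) =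
      ((intMinpoly α).map (algebraMap ℤ ℚ)).map (algebraMap ℚ ℂ) := by
    rw [Polynomial.map_map]; congr 1
  rw [this, h, Polynomial.map_mul, map_C, roots_C_mul _ (by simpa using hc)]

lemma lc_of_integral (α : ℂ) (hα : IsIntegral ℤ α) : (intMinpoly α).leadingCoeff.natAbs = 1 := by
  have hα' : IsAlgebraic ℚ α := hα.tower_top.isAlgebraic
  obtain ⟨c, hc, h⟩ := intMinpoly_map α hα'
  have hm : (minpoly ℤ α).map (algebraMap ℤ ℚ) = minpoly ℚ α :=
    (minpoly.isIntegrallyClosed_eq_field_fractions' ℚ hα).symm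
  have hdvd : intMinpoly α ∣ minpoly ℤ α := by
    apply (intMinpoly_primitive α).dvd_of_fraction_map_dvd_fraction_map (K := ℚ)
    rw [h, hm]
    exact ⟨C c⁻¹, by rw [mul_comm (C c), mul_assoc, ← C_mul, mul_inv_cancel₀ hc]; simp⟩
  have := leadingCoeff_dvd_leadingCoeff hdvd
  rw [(minpoly.monic hα).leadingCoeff] at this
  exact Int.isUnit_iff_natAbs_eq.1 (isUnit_of_dvd_one this)

lemma mahlerM_eq (α : ℂ) :
    mahlerM α = ((intMinpoly α).map (Int.castRingHom ℂ)).mahlerMeasure := by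
  rw [mahlerMeasure_eq_leadingCoeff_mul_prod_roots, mahlerM,
    leadingCoeff_map_of_injective (Int.castRingHom ℂ).injective_int]
  congr 1
  simp [Nat.cast_natAbs]

lemma one_le_M (α : ℂ) : 1 ≤ mahlerM α := by
  rw [mahlerM_eq]
  exact one_le_mahlerMeasure_of_ne_zero (intMinpoly_primitive α).ne_zero

lemma alpha_root (α : ℂ) (hα : IsAlgebraic ℚ α) :
    α ∈ ((intMinpoly α).map (Int.castRingHom ℂ)).roots := by
  rw [intMinpoly_roots α hα, mem_aroots]
  exact ⟨minpoly.ne_zero hα.isIntegral, minpoly.aeval _ _⟩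

lemma one_lt_M (α : ℂ) (hα : IsAlgebraic ℚ α)
    (h0 : α ≠ 0) (hru : ∀ m : ℕ, 0 < m → α ^ m ≠ 1) : 1 < mahlerM α := by
  refine lt_of_le_of_ne (one_le_M α) fun h => ?_
  rw [mahlerM_eq] at h
  obtain ⟨n, hn, h1⟩ := pow_eq_one_of_mahlerMeasure_eq_one (p := intMinpoly α) (z := α) h.symm h0
    (by simpa [aroots_def] using alpha_root α hα)
  exact hru n hn h1

noncomputable abbrev NN := algebraicClosure ℚ ℂ

instance instNN1 : IsAlgClosure ℚ NN := algebraicClosure.isAlgClosure ℚ ℂ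
instance instNN2 : Algebra.IsAlgebraic ℚ NN := algebraicClosure.isAlgebraic ℚ ℂ
instance instNN3 : Normal ℚ NN := IsAlgClosure.normal ℚ NN

noncomputable def rN (x : NN) : Finset NN := ((minpoly ℚ x).aroots NN).toFinset

lemma mem_rN (x y : NN) : y ∈ rN x ↔ ∃ σ : NN ≃ₐ[ℚ] NN, σ x = y := by
  have hx : IsIntegral ℚ x := Algebra.IsIntegral.isIntegral x
  rw [rN, Multiset.mem_toFinset, ← isConjRoot_iff_mem_minpoly_aroots hx,
    IsConjRoot.comm, isConjRoot_iff_exists_algEquiv]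

lemma sigma_mem (σ : NN ≃ₐ[ℚ] NN) (x y : NN) (h : y ∈ rN x) : σ y ∈ rN x := by
  obtain ⟨τ, rfl⟩ := (mem_rN _ _).1 h
  exact (mem_rN _ _).2 ⟨τ.trans σ, rfl⟩

lemma aroots_eq (x : NN) : (minpoly ℚ (x : ℂ)).aroots ℂ = (rN x).val.map (fun z : NN => (z : ℂ)) := by
  have hx : IsIntegral ℚ x := Algebra.IsIntegral.isIntegral x
  have h1 : minpoly ℚ (x : ℂ) = minpoly ℚ x :=
    minpoly.algebraMap_eq (algebraMap NN ℂ).injective x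
  have hs : ((minpoly ℚ x).map (algebraMap ℚ NN)).Splits := Normal.splits inferInstance x
  have hn : ((minpoly ℚ x).aroots NN).Nodup :=
    nodup_roots ((minpoly.irreducible hx).separable.map)
  rw [rN, Multiset.toFinset_val, Multiset.dedup_eq_self.2 hn, h1, aroots_def, aroots_def,
    IsScalarTower.algebraMap_eq ℚ NN ℂ, ← Polynomial.map_map, hs.roots_map]
  rfl

lemma coe_alg (x : NN) : IsAlgebraic ℚ (x : ℂ) := mem_algebraicClosure_iff.1 x.2

lemma mahlerM_N (x : NN) : mahlerM (x : ℂ) =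
    ((intMinpoly (x : ℂ)).leadingCoeff.natAbs : ℝ) * ∏ z ∈ rN x, max 1 ‖(z : ℂ)‖ := by
  rw [mahlerM, intMinpoly_roots _ (coe_alg x), aroots_eq, Multiset.map_map]
  rfl

noncomputable def conjN : NN ≃ₐ[ℚ] NN :=
  AlgEquiv.restrictNormal (Complex.conjAe.restrictScalars ℚ) NN

lemma conjN_coe (x : NN) : ((conjN x : NN) : ℂ) = (starRingEnd ℂ) (x : ℂ) :=
  AlgEquiv.restrictNormal_commutes (Complex.conjAe.restrictScalars ℚ) NN x

noncomputable def SS (x : NN) : Finset NN := (rN x).filter (fun z : NN => 1 < ‖(z : ℂ)‖)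

lemma prod_SS (x : NN) : ∏ z ∈ rN x, max 1 ‖(z : ℂ)‖ = ‖((∏ z ∈ SS x, z : NN) : ℂ)‖ := by
  have : ((∏ z ∈ SS x, z : NN) : ℂ) = ∏ z ∈ SS x, (z : ℂ) := map_prod (algebraMap NN ℂ) _ _
  rw [this, norm_prod, SS, Finset.prod_filter]
  refine Finset.prod_congr rfl fun z _ => ?_
  split_ifs with h
  · exact max_eq_right h.le
  · exact max_eq_left (not_lt.1 h)

lemma conj_P (x : NN) : conjN (∏ z ∈ SS x, z) = ∏ z ∈ SS x, z := by
  rw [map_prod]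
  refine Finset.prod_nbij conjN ?_ conjN.injective.injOn ?_ (fun _ _ => rfl)
  · intro z hz
    simp only [SS, Finset.mem_filter] at hz ⊢
    exact ⟨sigma_mem _ _ _ hz.1, by rw [conjN_coe, Complex.norm_conj]; exact hz.2⟩
  · intro z hz
    simp only [SS, Finset.coe_filter, Set.mem_ofPred_eq, Set.mem_image] at hz ⊢
    refine ⟨conjN z, ⟨sigma_mem _ _ _ hz.1, by rw [conjN_coe, Complex.norm_conj]; exact hz.2⟩, ?_⟩
    apply Subtype.ext
    rw [conjN_coe, conjN_coe, Complex.conj_conj]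

lemma norm_P (x : NN) : ∃ ε : ℤ, |ε| = 1 ∧
    ((‖((∏ z ∈ SS x, z : NN) : ℂ)‖ : ℝ) : ℂ) = ε * ((∏ z ∈ SS x, z : NN) : ℂ) := by
  have h := congrArg (fun z : NN => (z : ℂ)) (conj_P x)
  simp only [conjN_coe] at h
  set P := ((∏ z ∈ SS x, z : NN) : ℂ)
  obtain ⟨r, hr⟩ := Complex.conj_eq_iff_real.1 h
  rw [hr]
  rcases abs_choice r with h1 | h1
  · exact ⟨1, by simp, by simp [h1]⟩
  · exact ⟨-1, by simp, by simp [h1]⟩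

/-- structure of Mahler measures -/
lemma mahler_struct (x : NN) : ∃ (g : NN) (c : ℤ), c ≠ 0 ∧ (g : ℂ) = mahlerC x ∧
    g = c * ∏ z ∈ SS x, z ∧ |c| = |(intMinpoly (x : ℂ)).leadingCoeff| := by
  obtain ⟨ε, hε, h⟩ := norm_P x
  have hl : (intMinpoly (x : ℂ)).leadingCoeff ≠ 0 :=
    leadingCoeff_ne_zero.2 (intMinpoly_primitive _).ne_zero
  refine ⟨_, |(intMinpoly (x : ℂ)).leadingCoeff| * ε, ?_, ?_, rfl, ?_⟩
  · intro h0
    have : |(|(intMinpoly (x : ℂ)).leadingCoeff| * ε)| = 0 := by rw [h0]; simp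
    rw [abs_mul, hε, abs_abs, mul_one] at this
    exact hl (abs_eq_zero.1 this)
  · rw [mahlerC, mahlerM_N, prod_SS, Complex.ofReal_mul, h]
    push_cast
    rw [Nat.cast_natAbs]
    push_cast
    ring
  · rw [abs_mul, hε, abs_abs, mul_one]

lemma mahler_integral (x : NN) : IsIntegral ℤ (mahlerC (x : ℂ)) := by
  obtain ⟨g, c, hc, hg, hg2, hc2⟩ := mahler_struct x
  have h1 : IsIntegral ℤ (((intMinpoly (x : ℂ)).leadingCoeff : ℂ) *
      ((SS x).val.map (fun z : NN => (z : ℂ))).prod) := by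
    apply aux_prod _ _ (((rN x).filter (fun z : NN => ¬ 1 < ‖(z : ℂ)‖)).val.map (fun z : NN => (z : ℂ)))
    have e1 : ((rN x).filter (fun z : NN => ¬ 1 < ‖(z : ℂ)‖)).val.map (fun z : NN => (z : ℂ)) +
        (SS x).val.map (fun z : NN => (z : ℂ)) = ((intMinpoly (x : ℂ)).map (Int.castRingHom ℂ)).roots := by
      rw [intMinpoly_roots _ (coe_alg x), aroots_eq, ← Multiset.map_add, SS, Finset.filter_val,
        Finset.filter_val, add_comm, Multiset.filter_add_not]
    have e2 := (IsAlgClosed.splits ((intMinpoly (x : ℂ)).map (Int.castRingHom ℂ))).eq_prod_roots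
    rw [leadingCoeff_map_of_injective (Int.castRingHom ℂ).injective_int] at e2
    intro i
    rw [e1]
    have e3 : ((intMinpoly (x : ℂ)).leadingCoeff : ℂ) =
      (Int.castRingHom ℂ) (intMinpoly (x : ℂ)).leadingCoeff := rfl
    rw [e3, ← e2, coeff_map]
    exact isIntegral_algebraMap (R := ℤ)
  have h2 : ((SS x).val.map (fun z : NN => (z : ℂ))).prod = ((∏ z ∈ SS x, z : NN) : ℂ) :=
    (map_prod (algebraMap NN ℂ) _ _).symm
  rw [h2] at h1
  rw [← hg, hg2]
  have h3 : ((c * ∏ z ∈ SS x, z : NN) : ℂ) = (c : ℂ) * ((∏ z ∈ SS x, z : NN) : ℂ) := by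
    simp
  rw [h3]
  rcases abs_eq_abs.1 hc2 with h | h
  · rw [h]; exact h1
  · rw [h]; simpa using h1.neg

lemma perron (x g : NN) (hg : (g : ℂ) = mahlerC x) (σ : NN ≃ₐ[ℚ] NN)
    (h : ‖(g : ℂ)‖ ≤ ‖((σ g : NN) : ℂ)‖) : σ g = g := by
  obtain ⟨g', c, hc, hg', hg2, -⟩ := mahler_struct x
  obtain rfl : g = g' := Subtype.ext (hg.trans hg'.symm)
  have hσ : σ g = c * ∏ z ∈ (SS x).image σ, z := by
    rw [hg2, map_mul, map_intCast, map_prod, Finset.prod_image σ.injective.injOn]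
  suffices hS : (SS x).image σ = SS x by rw [hσ, hS, ← hg2]
  have hco : ∀ T : Finset NN, ‖((c * ∏ z ∈ T, z : NN) : ℂ)‖ = ‖(c : ℂ)‖ * ∏ z ∈ T, ‖(z : ℂ)‖ := by
    intro T
    have : ((c * ∏ z ∈ T, z : NN) : ℂ) = (c : ℂ) * ∏ z ∈ T, (z : ℂ) := by
      have e : ((∏ z ∈ T, z : NN) : ℂ) = ∏ z ∈ T, (z : ℂ) := map_prod (algebraMap NN ℂ) _ _
      rw [← e]
      simp
    rw [this, norm_mul, norm_prod]
  rw [hσ, hg2, hco, hco] at h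
  have hc' : 0 < ‖(c : ℂ)‖ := by simpa using hc
  have h' := le_of_mul_le_mul_left h hc'
  set T := (SS x).image σ
  have hTr : T ⊆ rN x := by
    intro y hy
    obtain ⟨z, hz, rfl⟩ := Finset.mem_image.1 hy
    exact sigma_mem _ _ _ (Finset.mem_filter.1 hz).1
  have hcard : T.card = (SS x).card := Finset.card_image_of_injective _ σ.injective
  by_contra hne
  have hns : ¬ SS x ⊆ T := fun hs => hne (Finset.eq_of_subset_of_card_le hs hcard.le).symm
  obtain ⟨w, hw, hwT⟩ := Finset.not_subset.1 hns
  have hin : ∀ z ∈ SS x, 1 < ‖(z : ℂ)‖ := fun z hz => (Finset.mem_filter.1 hz).2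
  have a1 : ∏ z ∈ T, ‖(z : ℂ)‖ ≤ ∏ z ∈ T ∩ SS x, ‖(z : ℂ)‖ := by
    rw [← Finset.prod_inter_mul_prod_sdiff T (SS x)]
    refine mul_le_of_le_one_right (Finset.prod_nonneg fun _ _ => norm_nonneg _) ?_
    refine Finset.prod_le_one (fun _ _ => norm_nonneg _) fun z hz => ?_
    rw [Finset.mem_sdiff] at hz
    by_contra hlt
    exact hz.2 (Finset.mem_filter.2 ⟨hTr hz.1, not_le.1 hlt⟩)
  have a2 : ∏ z ∈ T ∩ SS x, ‖(z : ℂ)‖ < ∏ z ∈ SS x, ‖(z : ℂ)‖ := by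
    rw [← Finset.prod_inter_mul_prod_sdiff (SS x) T, Finset.inter_comm]
    refine lt_mul_of_one_lt_right (Finset.prod_pos fun z hz => ?_) ?_
    · exact one_pos.trans (hin z (Finset.mem_inter.1 hz).1)
    · have hwd : w ∈ SS x \ T := Finset.mem_sdiff.2 ⟨hw, hwT⟩
      rw [← Finset.mul_prod_erase _ _ hwd]
      refine one_lt_mul_of_lt_of_le (hin w hw) ?_
      have := Finset.prod_le_prod (s := (SS x \ T).erase w) (f := fun _ => (1:ℝ))
        (g := fun z : NN => ‖(z : ℂ)‖) (fun _ _ => zero_le_one)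
        (fun z hz => (hin z (Finset.mem_sdiff.1 (Finset.mem_of_mem_erase hz)).1).le)
      simpa using this
  linarith

/-- Powers of Mahler measures. -/
lemma mahler_pow (x g : NN) (hg : (g : ℂ) = mahlerC x) (n : ℕ) (hn : n ≠ 0) :
    mahlerM ((g : ℂ) ^ n) = mahlerM (g : ℂ) ^ n := by
  have hint : IsIntegral ℤ (g : ℂ) := by rw [hg]; exact mahler_integral x
  have hco : ((g ^ n : NN) : ℂ) = (g : ℂ) ^ n := by simp
  rw [← hco, mahlerM_N, mahlerM_N, lc_of_integral _ hint,
    lc_of_integral _ (by rw [hco]; exact hint.pow n)]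
  have hr : rN (g ^ n) = (rN g).image (fun z => z ^ n) := by
    ext y
    rw [mem_rN, Finset.mem_image]
    constructor
    · rintro ⟨σ, rfl⟩
      exact ⟨σ g, (mem_rN _ _).2 ⟨σ, rfl⟩, by simp⟩
    · rintro ⟨z, hz, rfl⟩
      obtain ⟨σ, rfl⟩ := (mem_rN _ _).1 hz
      exact ⟨σ, by simp⟩
  rw [hr, Finset.prod_image]
  · simp only [Nat.cast_one, one_mul]
    rw [← Finset.prod_pow]
    refine Finset.prod_congr rfl fun z _ => ?_
    have : ((z ^ n : NN) : ℂ) = (z : ℂ) ^ n := by simp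
    rw [this, norm_pow]
    rcases le_total 1 ‖(z : ℂ)‖ with h | h
    · rw [max_eq_right h, max_eq_right (one_le_pow₀ h)]
    · rw [max_eq_left h, max_eq_left (pow_le_one₀ (norm_nonneg _) h), one_pow]
  · intro y hy z hz hyz
    obtain ⟨σ, rfl⟩ := (mem_rN _ _).1 hy
    obtain ⟨τ, rfl⟩ := (mem_rN _ _).1 hz
    simp only at hyz
    have h1 : ((σ.trans τ.symm) g) ^ n = g ^ n := by
      rw [AlgEquiv.trans_apply, ← map_pow, hyz, map_pow, AlgEquiv.symm_apply_apply]
    have h2 : ‖(((σ.trans τ.symm) g : NN) : ℂ)‖ = ‖(g : ℂ)‖ := by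
      have h3 := congrArg (fun z : NN => ‖(z : ℂ)‖) h1
      simp only [SubmonoidClass.coe_pow, norm_pow] at h3
      exact (pow_left_inj₀ (norm_nonneg _) (norm_nonneg _) hn).1 h3
    have h3 := perron x g hg (σ.trans τ.symm) h2.ge
    rw [AlgEquiv.trans_apply, AlgEquiv.symm_apply_eq] at h3
    exact h3

lemma mahler_alg (α : ℂ) (hα : IsAlgebraic ℚ α) : IsAlgebraic ℚ (mahlerC α) := by
  have := mahler_integral ⟨α, mem_algebraicClosure_iff.2 hα⟩
  exact this.tower_top.isAlgebraic

lemma iter_alg (α : ℂ) (hα : IsAlgebraic ℚ α) (j : ℕ) : IsAlgebraic ℚ (mahlerC^[j] α) := by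
  induction j with
  | zero => exact hα
  | succ j ih => rw [Function.iterate_succ_apply']; exact mahler_alg _ ih

/-- powers of `M y`. -/
lemma mahlerC_pow (y : ℂ) (hy : IsAlgebraic ℚ y) (n : ℕ) (hn : n ≠ 0) :
    mahlerC (mahlerC y ^ n) = mahlerC (mahlerC y) ^ n := by
  have := mahler_pow ⟨y, mem_algebraicClosure_iff.2 hy⟩
    ⟨mahlerC y, mem_algebraicClosure_iff.2 (mahler_alg y hy)⟩ rfl n hn
  rw [mahlerC, this, Complex.ofReal_pow]
  rfl

lemma iter_pow (y : ℂ) (hy : IsAlgebraic ℚ y) (n : ℕ) (hn : n ≠ 0) (j : ℕ) :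
    mahlerC^[j] (mahlerC y ^ n) = (mahlerC^[j] (mahlerC y)) ^ n := by
  induction j with
  | zero => rfl
  | succ j ih =>
    rw [Function.iterate_succ_apply', ih, ← Function.iterate_succ_apply,
      Function.iterate_succ_apply', mahlerC_pow _ (iter_alg _ hy j) n hn,
      ← Function.iterate_succ_apply' mahlerC j y, Function.iterate_succ_apply,
      ← Function.iterate_succ_apply' mahlerC j (mahlerC y)]

lemma norm_le_M (y : ℂ) (hy : IsAlgebraic ℚ y) : ‖y‖ ≤ mahlerM y := by
  let x : NN := ⟨y, mem_algebraicClosure_iff.2 hy⟩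
  have h := mahlerM_N x
  have hx : x ∈ rN x := (mem_rN _ _).2 ⟨AlgEquiv.refl, rfl⟩
  have hl : (1 : ℝ) ≤ ((intMinpoly (x : ℂ)).leadingCoeff.natAbs : ℝ) := by
    have : (intMinpoly (x : ℂ)).leadingCoeff ≠ 0 :=
      leadingCoeff_ne_zero.2 (intMinpoly_primitive _).ne_zero
    exact_mod_cast Int.natAbs_pos.2 this
  have h1 : ‖y‖ ≤ ∏ z ∈ rN x, max 1 ‖(z : ℂ)‖ := by
    rw [← Finset.mul_prod_erase _ _ hx]
    have h2 : (1 : ℝ) ≤ ∏ z ∈ (rN x).erase x, max 1 ‖(z : ℂ)‖ := by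
      have := Finset.prod_le_prod (s := (rN x).erase x) (f := fun _ => (1:ℝ))
        (g := fun z : NN => max 1 ‖(z : ℂ)‖) (fun _ _ => zero_le_one) (fun z hz => le_max_left _ _)
      simpa using this
    have h3 : ‖y‖ ≤ max 1 ‖(x : ℂ)‖ := le_max_right _ _
    exact h3.trans (le_mul_of_one_le_right (by positivity) h2)
  change mahlerM y = _ at h
  rw [h]
  exact h1.trans (le_mul_of_one_le_left ((norm_nonneg _).trans h1) hl)

lemma norm_mahlerC (y : ℂ) : ‖mahlerC y‖ = mahlerM y := by
  rw [mahlerC, Complex.norm_real, Real.norm_of_nonneg (zero_le_one.trans (one_le_M y))]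

theorem wandering_of_iterate_eq_iterate_pow (α : ℂ) (hα : IsAlgebraic ℚ α)
    (h0 : α ≠ 0) (hru : ∀ m : ℕ, 0 < m → α ^ m ≠ 1)
    (k l n : ℕ) (hl : 0 < l) (hkl : l < k) (hn : 2 ≤ n)
    (heq : mahlerC^[k] α = (mahlerC^[l] α) ^ n) :
    (Set.range fun m : ℕ => mahlerC^[m] α).Infinite := by
  obtain ⟨l, rfl⟩ := Nat.exists_eq_succ_of_ne_zero hl.ne'
  obtain ⟨d, rfl⟩ := Nat.exists_eq_add_of_lt hkl
  have hbig : ∀ j, 1 < ‖mahlerC^[j + 1] α‖ := by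
    intro j
    induction j with
    | zero => simpa [norm_mahlerC] using one_lt_M α hα h0 hru
    | succ j ih =>
      rw [Function.iterate_succ_apply', norm_mahlerC]
      exact ih.trans_le (norm_le_M _ (iter_alg _ hα _))
  have hiter : ∀ j, mahlerC^[j * (d + 1) + (l + 1)] α = (mahlerC^[l + 1] α) ^ n ^ j := by
    intro j
    induction j with
    | zero => simp
    | succ j ih =>
      have e : (j + 1) * (d + 1) + (l + 1) = (d + 1) + (j * (d + 1) + (l + 1)) := by ring
      rw [e, Function.iterate_add_apply, ih, Function.iterate_succ_apply' mahlerC l,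
        iter_pow _ (iter_alg _ hα l) _ (by positivity), ← Function.iterate_succ_apply' mahlerC l,
        ← Function.iterate_add_apply]
      have e2 : d + 1 + (l + 1) = l.succ + d + 1 := by simp only [Nat.succ_eq_add_one]; ring
      rw [e2, heq, ← pow_mul, pow_succ, mul_comm]
  refine Set.infinite_of_injective_forall_mem (f := fun j : ℕ => (mahlerC^[l + 1] α) ^ n ^ j) ?_ ?_
  · intro i j hij
    have h1 := congrArg (fun z : ℂ => ‖z‖) hij
    simp only [norm_pow] at h1
    have h2 := pow_right_injective₀ (zero_lt_one.trans (hbig l)) (hbig l).ne' h1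
    exact Nat.pow_right_injective hn h2
  · intro j
    exact ⟨_, hiter j⟩
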